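/- arXiv:2605.23319 — 6 statements merged into one kernel-verified Lean document; each statement's English description precedes it below -/
import Mathlib

section
/- For any finite directed acyclic graph G, the node scanwidth does not increase when passing to a (not necessarily induced) subgraph: if G' is obtained from G by deleting edges and/or vertices, then nsw(G') ≤ nsw(G). -/
/-! Node scanwidth framework.

A directed graph on a vertex type `V` is given by its edge relation `E : V → V → Prop`.
A rooted tree on `V` is encoded by a parent function `p : V → Option V` together with a
root `r` having no parent such that the root reaches every vertex along parent-child edges.
A tree-extension of `E` additionally requires that for every edge `u → v` of `E`,
the vertex `u` is an ancestor of `v` in the tree. -/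

/-- `u` is the parent of `v` with respect to the parent function `p`. -/
def pEdge {V : Type*} (p : V → Option V) (u v : V) : Prop := p v = some u

/-- A tree-extension of the digraph with edge relation `E`. -/
structure TreeExt {V : Type*} (E : V → V → Prop) where
  parent : V → Option V
  root : V
  root_parent : parent root = none
  reach_root : ∀ v : V, Relation.ReflTransGen (pEdge parent) root v
  extends_edges : ∀ u v : V, E u v → Relation.ReflTransGen (pEdge parent) u v

/-- The set of descendants of `v` in the tree-extension `Γ` (the vertex set of `Γ_{≤v}`). -/
def descend {V : Type*} {E : V → V → Prop} (Γ : TreeExt E) (v : V) : Set V :=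
  {w | Relation.ReflTransGen (pEdge Γ.parent) v w}

/-- The node bag `GW(v, Γ)`: the `E`-parents of the subtree below `v` that lie outside it. -/
def nodeBag {V : Type*} {E : V → V → Prop} (Γ : TreeExt E) (v : V) : Set V :=
  {u | u ∉ descend Γ v ∧ ∃ w ∈ descend Γ v, E u w}

/-- The node scanwidth of a tree-extension: the maximum node-bag size. -/
noncomputable def nswTE {V : Type*} [Fintype V] {E : V → V → Prop} (Γ : TreeExt E) : ℕ :=
  Finset.univ.sup fun v : V => (nodeBag Γ v).ncard

/-- The node scanwidth of a digraph: the minimum over all tree-extensions. -/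
noncomputable def nsw {V : Type*} [Fintype V] (E : V → V → Prop) : ℕ :=
  sInf {n : ℕ | ∃ Γ : TreeExt E, nswTE Γ = n}

/-- Acyclicity of a directed graph. -/
def IsDAG {V : Type*} (E : V → V → Prop) : Prop := ∀ v : V, ¬ Relation.TransGen E v v

/-- The set of in-neighbours of `v`. -/
def parentsOf {V : Type*} (E : V → V → Prop) (v : V) : Set V := {u | E u v}

theorem exists_treeExt {W : Type*} [Finite W] (R : W → W → Prop) (hrefl : ∀ a, R a a)
    (htrans : ∀ a b c, R a b → R b c → R a c) (hanti : ∀ a b, R a b → R b a → a = b)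
    (r : W) (hr : ∀ v, R r v) (hchain : ∀ a b c, R a c → R b c → R a b ∨ R b a)
    (E : W → W → Prop) (hE : ∀ u v, E u v → R u v) :
    ∃ Γ : TreeExt E, ∀ v, descend Γ v = {w | R v w} := by
  classical
  let _ : PartialOrder W :=
    { le := R, le_refl := hrefl, le_trans := htrans, le_antisymm := hanti }
  have hle : ∀ a b : W, a ≤ b ↔ R a b := fun _ _ => Iff.rfl
  have key : ∀ v : W, ∃ p : Option W, (v = r → p = none) ∧
      (v ≠ r → ∃ q, p = some q ∧ q < v ∧ ∀ u, u < v → u ≤ q) := by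
    intro v
    by_cases h : v = r
    · exact ⟨none, fun _ => rfl, fun h' => absurd h h'⟩
    · have hne : (Set.Iio v).Nonempty := ⟨r, lt_of_le_of_ne (hr v) (Ne.symm h)⟩
      obtain ⟨q, hq⟩ := (Set.toFinite (Set.Iio v)).exists_maximal hne
      refine ⟨some q, fun h' => absurd h' h, fun _ => ⟨q, rfl, hq.1, fun u hu => ?_⟩⟩
      rcases hchain u q v hu.le (le_of_lt (show q < v from hq.1)) with h1 | h1
      · exact h1
      · exact hq.2 hu h1
  choose p hp0 hp1 using key
  have h1 : ∀ u v, Relation.ReflTransGen (pEdge p) u v → u ≤ v := by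
    intro u v h
    induction h with
    | refl => exact le_rfl
    | @tail b c _ hbc ih =>
      unfold pEdge at hbc
      have hc : c ≠ r := fun h => by simp [hp0 c h] at hbc
      obtain ⟨q, hq, hlt, _⟩ := hp1 c hc
      rw [hbc] at hq
      cases hq
      exact ih.trans hlt.le
  have h2 : ∀ v u, u ≤ v → Relation.ReflTransGen (pEdge p) u v := by
    intro v
    induction v using WellFoundedLT.induction with
    | ind v ih =>
      intro u huv
      rcases eq_or_lt_of_le huv with rfl | hlt
      · exact .refl
      · have hv : v ≠ r := by
          rintro rfl
          exact absurd (hr u) (not_le_of_gt hlt)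
        obtain ⟨q, hq, hqv, hmax⟩ := hp1 v hv
        exact (ih q hqv u (hmax u hlt)).tail hq
  refine ⟨⟨p, r, hp0 r rfl, fun v => h2 v r (hr v), fun u v h => h2 v u (hE u v h)⟩, fun v => ?_⟩
  ext w
  exact ⟨h1 v w, h2 w v⟩

theorem TreeExt.antisymm_aux {V : Type*} {E : V → V → Prop} (Γ : TreeExt E) (v : V) :
    ¬ Relation.TransGen (pEdge Γ.parent) v v := by
  have h := Γ.reach_root v
  induction h with
  | refl =>
    intro h
    obtain ⟨b, _, hb⟩ := Relation.TransGen.tail'_iff.1 h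
    unfold pEdge at hb
    simp [Γ.root_parent] at hb
  | @tail b c _ hbc ih =>
    intro h
    obtain ⟨d, hd, hdc⟩ := Relation.TransGen.tail'_iff.1 h
    unfold pEdge at hbc hdc
    have : d = b := by
      rw [hbc] at hdc
      exact (Option.some.inj hdc).symm
    subst this
    exact ih (Relation.TransGen.head' hbc hd)

theorem rtg_antisymm {V : Type*} {E : V → V → Prop} (h : ∀ v, ¬ Relation.TransGen E v v)
    (a b : V) (hab : Relation.ReflTransGen E a b) (hba : Relation.ReflTransGen E b a) : a = b := by
  rcases Relation.reflTransGen_iff_eq_or_transGen.1 hab with h1 | h1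
  · exact h1.symm
  · exact absurd (h1.trans_left hba) (h a)

theorem TreeExt.chain {V : Type*} {E : V → V → Prop} (Γ : TreeExt E) (a b c : V)
    (hac : Relation.ReflTransGen (pEdge Γ.parent) a c)
    (hbc : Relation.ReflTransGen (pEdge Γ.parent) b c) :
    Relation.ReflTransGen (pEdge Γ.parent) a b ∨ Relation.ReflTransGen (pEdge Γ.parent) b a := by
  have U : Relator.RightUnique (Function.swap (pEdge Γ.parent)) := by
    intro x y z hy hz
    have hy' : Γ.parent x = some y := hy
    have hz' : Γ.parent x = some z := hz
    rw [hy'] at hz'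
    exact Option.some.inj hz'
  have := Relation.ReflTransGen.total_of_right_unique U
    (Relation.reflTransGen_swap.2 hac) (Relation.reflTransGen_swap.2 hbc)
  rcases this with h | h
  · exact Or.inr (Relation.reflTransGen_swap.1 h)
  · exact Or.inl (Relation.reflTransGen_swap.1 h)

theorem exists_treeExt_of_isDAG {V : Type*} [Finite V] [Nonempty V] (E : V → V → Prop)
    (hdag : IsDAG E) : Nonempty (TreeExt E) := by
  let _ : PartialOrder V :=
    { le := Relation.ReflTransGen E, le_refl := fun _ => .refl,
      le_trans := fun _ _ _ => .trans, le_antisymm := rtg_antisymm hdag }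
  have : Finite (LinearExtension V) := ‹Finite V›
  have : Nonempty (LinearExtension V) := ‹Nonempty V›
  obtain ⟨r, hr⟩ := Finite.exists_min (id : LinearExtension V → LinearExtension V)
  obtain ⟨Γ, _⟩ := exists_treeExt (W := V)
    (fun a b => toLinearExtension a ≤ toLinearExtension b)
    (fun a => le_rfl) (fun a b c => le_trans) (fun a b h1 h2 => le_antisymm (α := LinearExtension V) h1 h2) r
    (fun v => hr v) (fun a b _ _ _ => le_total (toLinearExtension a) (toLinearExtension b)) E
    (fun u v h => toLinearExtension.monotone (Relation.ReflTransGen.single h))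
  exact ⟨Γ⟩

theorem restrict_treeExt {V : Type*} [Fintype V] (E : V → V → Prop)
    (V' : Set V) [Fintype V'] [Nonempty V'] (E' : V' → V' → Prop)
    (hsub : ∀ u v : V', E' u v → E u.1 v.1) (Γ : TreeExt E) :
    ∃ Γ' : TreeExt E', nswTE Γ' ≤ nswTE Γ := by
  classical
  let T : V → V → Prop := Relation.ReflTransGen (pEdge Γ.parent)
  have hanti : ∀ a b, T a b → T b a → a = b := rtg_antisymm Γ.antisymm_aux
  have htr : ∀ a b c, T a b → T b c → T a c := fun _ _ _ => .trans
  obtain ⟨r, hr⟩ : ∃ r : V', ∀ v : V', T v r → v = r := by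
    let _ : PartialOrder V' :=
      { le := fun a b => T a b, le_refl := fun _ => .refl,
        le_trans := fun _ _ _ => .trans,
        le_antisymm := fun a b h1 h2 => Subtype.ext (hanti a b h1 h2) }
    obtain ⟨r, hr⟩ := (Set.toFinite (Set.univ : Set V')).exists_minimal Set.univ_nonempty
    exact ⟨r, fun v hv => le_antisymm (α := V') hv (hr.2 trivial hv)⟩
  obtain ⟨Γ', hΓ'⟩ := exists_treeExt (W := V') (fun a b => a = r ∨ T a b)
    (fun a => Or.inr .refl)
    (by
      rintro a b c (h | h) (h' | h')
      · exact Or.inl h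
      · exact Or.inl h
      · subst h'
        exact Or.inl (hr a h)
      · exact Or.inr (htr _ _ _ h h'))
    (by
      rintro a b (h | h) (h' | h')
      · rw [h, h']
      · subst h
        exact (hr b h').symm
      · subst h'
        exact hr a h
      · exact Subtype.ext (hanti _ _ h h'))
    r (fun v => Or.inl rfl)
    (by
      rintro a b c (h | h) (h' | h')
      · exact Or.inl (Or.inl h)
      · exact Or.inl (Or.inl h)
      · exact Or.inr (Or.inl h')
      · rcases Γ.chain a b c h h' with h | h
        · exact Or.inl (Or.inr h)
        · exact Or.inr (Or.inr h))
    E' (fun u v h => Or.inr (Γ.extends_edges _ _ (hsub u v h)))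
  refine ⟨Γ', Finset.sup_le fun v _ => ?_⟩
  refine le_trans ?_ (Finset.le_sup (f := fun v : V => (nodeBag Γ v).ncard) (Finset.mem_univ v.1))
  rw [← Set.ncard_image_of_injective (nodeBag Γ' v) Subtype.val_injective]
  refine Set.ncard_le_ncard ?_ (Set.toFinite _)
  rintro _ ⟨u, ⟨hu, w, hw, huw⟩, rfl⟩
  rw [hΓ'] at hu hw
  have hv : v ≠ r := fun h => hu (Or.inl h)
  exact ⟨fun h => hu (Or.inr h), w.1, hw.resolve_left hv, hsub u w huw⟩

/-- The node scanwidth does not increase when passing to a (not necessarily induced)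
subgraph: if `G'` is obtained from the finite DAG `G` by deleting edges and/or vertices
(its vertex set is `V' ⊆ V` and its edge relation implies that of `G`), then
`nsw(G') ≤ nsw(G)`. -/
theorem stmt1 {V : Type*} [Fintype V] (E : V → V → Prop) (hdag : IsDAG E)
    (V' : Set V) [Fintype V'] (E' : V' → V' → Prop)
    (hsub : ∀ u v : V', E' u v → E u.1 v.1) :
    nsw E' ≤ nsw E := by
  rcases isEmpty_or_nonempty V' with hV | hV
  · have : nsw E' = 0 := by
      unfold nsw
      rw [Nat.sInf_eq_zero]
      right
      ext n
      simp only [Set.mem_ofPred_eq, Set.mem_empty_iff_false, iff_false]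
      rintro ⟨Γ, _⟩
      exact hV.elim Γ.root
    omega
  · have : Nonempty V := ⟨hV.some.1⟩
    obtain ⟨Γ₀⟩ := exists_treeExt_of_isDAG E hdag
    obtain ⟨Γ, hΓ⟩ : nsw E ∈ {n : ℕ | ∃ Γ : TreeExt E, nswTE Γ = n} :=
      Nat.sInf_mem ⟨_, Γ₀, rfl⟩
    obtain ⟨Γ', hΓ'⟩ := restrict_treeExt E V' E' hsub Γ
    rw [← hΓ]
    exact le_trans (Nat.sInf_le ⟨Γ', rfl⟩) hΓ'
end

section
/- Let G be a finite directed acyclic graph and let v be a chain vertex of G (a vertex with in-degree 1 and out-degree 1) with unique child w. Then there is an optimal tree-extension Γ of G (i.e. nsw(Γ) = nsw(G)) in which w is the only child of v in Γ, and which satisfies GW(v,Γ) ⊆ GW(w,Γ) ∪ parents(v) and GW(w,Γ) ⊆ GW(v,Γ) ∪ parents(w), where parents are taken in G. -/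
open Relation

theorem pE_acyc {V : Type*} {E : V → V → Prop} (Γ : TreeExt E) (x : V) :
    ¬ TransGen (pEdge Γ.parent) x x := by
  have h := Γ.reach_root x
  induction h with
  | refl =>
    intro h
    obtain ⟨b, _, hb⟩ := TransGen.tail'_iff.1 h
    have := Γ.root_parent
    simp [pEdge, this] at hb
  | tail _ hbc ih =>
    intro h
    obtain ⟨d, hd, hdc⟩ := TransGen.tail'_iff.1 h
    simp only [pEdge] at hbc hdc
    rw [hbc] at hdc
    cases hdc
    exact ih (TransGen.head' (show pEdge Γ.parent _ _ from hbc) hd)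

theorem pE_antisymm {V : Type*} {E : V → V → Prop} (Γ : TreeExt E) {x y : V}
    (h1 : ReflTransGen (pEdge Γ.parent) x y) (h2 : ReflTransGen (pEdge Γ.parent) y x) :
    x = y := by
  rcases reflTransGen_iff_eq_or_transGen.1 h1 with h | h
  · exact h.symm
  · exact absurd (h.trans_left h2) (pE_acyc Γ x)

theorem pE_total {V : Type*} {p : V → Option V} {x y z : V}
    (h1 : ReflTransGen (pEdge p) x z) (h2 : ReflTransGen (pEdge p) y z) :
    ReflTransGen (pEdge p) x y ∨ ReflTransGen (pEdge p) y x := by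
  have U : Relator.RightUnique (Function.swap (pEdge p)) := by
    intro a b c hb hc
    simp only [Function.swap, pEdge] at hb hc
    rw [hb] at hc
    exact Option.some.inj hc
  have := ReflTransGen.total_of_right_unique U (reflTransGen_swap.2 h1) (reflTransGen_swap.2 h2)
  rcases this with h | h
  · exact Or.inr (reflTransGen_swap.1 h)
  · exact Or.inl (reflTransGen_swap.1 h)

theorem exists_treeExt_s2 {V : Type*} [Fintype V] [Nonempty V] (E : V → V → Prop)
    (hdag : IsDAG E) : Nonempty (TreeExt E) := by
  classical
  have hpo : IsPartialOrder V (ReflTransGen E) :=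
    { refl := fun _ => .refl
      trans := fun _ _ _ => ReflTransGen.trans
      antisymm := by
        intro a b h1 h2
        rcases reflTransGen_iff_eq_or_transGen.1 h1 with h | h
        · exact h.symm
        · exact absurd (h.trans_left h2) (hdag a) }
  obtain ⟨s, hs, hle⟩ := extend_partialOrder (ReflTransGen E)
  obtain ⟨n, hn⟩ : ∃ n, Fintype.card V = n + 1 :=
    ⟨Fintype.card V - 1, by have := Fintype.card_pos (α := V); omega⟩
  let L : LinearOrder V :=
    { le := s
      le_refl := hs.refl
      le_trans := hs.trans
      le_antisymm := hs.antisymm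
      le_total := hs.total
      toDecidableLE := Classical.decRel _ }
  let e : Fin (n+1) ≃o V := monoEquivOfFin V hn
  let p : V → Option V := fun v => if h : e.symm v = 0 then none else some (e ((e.symm v).pred h).castSucc)
  have key : ∀ (k : ℕ) (hk : k < n+1) (a : Fin (n+1)), a.val ≤ k →
      ReflTransGen (pEdge p) (e a) (e ⟨k, hk⟩) := by
    intro k
    induction k with
    | zero =>
      intro hk a ha
      have : a = ⟨0, hk⟩ := Fin.ext (by simpa using ha)
      rw [this]
    | succ k ih =>
      intro hk a ha
      rcases Nat.lt_or_ge k a.val with h | h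
      · have : a = ⟨k+1, hk⟩ := Fin.ext (by simp; omega)
        rw [this]
      · refine (ih (by omega) a h).tail ?_
        have h0 : (⟨k+1, hk⟩ : Fin (n+1)) ≠ 0 := by
          intro h; simpa using congrArg Fin.val h
        simp only [pEdge, p, OrderIso.symm_apply_apply, h0, dite_false]
        congr 1
  have key2 : ∀ a b : V, a ≤ b → ReflTransGen (pEdge p) a b := by
    intro a b hab
    have := key (e.symm b).val (e.symm b).isLt (e.symm a) (e.symm.monotone hab)
    simpa using this
  refine ⟨⟨p, e 0, by simp [p], ?_, ?_⟩⟩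
  · intro v
    apply key2
    have := e.monotone (Fin.zero_le (e.symm v))
    simpa using this
  · intro u v h
    exact key2 _ _ (hle _ _ (ReflTransGen.single h))

open Classical in
/-- the modified parent function -/
noncomputable def newP {V : Type*} (p : V → Option V) (v w : V) : V → Option V := fun x =>
  if x = w then some v else
    if x = v then (if p w = some v then p v else p w) else
      if p x = some v then p v else p x

theorem newP_iff {V : Type*} {E : V → V → Prop} (Γ : TreeExt E) {v w : V} (hvw : v ≠ w)
    (hR : ReflTransGen (pEdge Γ.parent) v w) (x y : V) :
    ReflTransGen (pEdge (newP Γ.parent v w)) x y ↔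
      (x ≠ v ∧ y ≠ v ∧ ReflTransGen (pEdge Γ.parent) x y) ∨
      (x ≠ v ∧ y = v ∧ x ≠ w ∧ ReflTransGen (pEdge Γ.parent) x w) ∨
      (x = v ∧ (y = v ∨ ReflTransGen (pEdge Γ.parent) w y)) := by
  have hwv : ¬ ReflTransGen (pEdge Γ.parent) w v := fun h => hvw (pE_antisymm Γ hR h)
  have hlast : ∀ a b c, ReflTransGen (pEdge Γ.parent) a b → a ≠ b → Γ.parent b = some c →
      ReflTransGen (pEdge Γ.parent) a c := by
    intro a b c h hab hc
    rcases ReflTransGen.cases_tail h with h | ⟨d, hd, hdb⟩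
    · exact absurd h.symm hab
    · simp only [pEdge] at hdb
      rw [hdb] at hc; cases hc; exact hd
  have hself : ∀ a, Γ.parent a ≠ some a := fun a h =>
    pE_acyc Γ a (TransGen.single (show pEdge _ _ _ from h))
  have step : ∀ a b c, ReflTransGen (pEdge Γ.parent) a b → Γ.parent c = some b →
      ReflTransGen (pEdge Γ.parent) a c := fun a b c h h2 => h.tail h2
  have A1 : ∀ x y, ReflTransGen (pEdge Γ.parent) x y → x ≠ v →
      (y ≠ v → ReflTransGen (pEdge (newP Γ.parent v w)) x y) ∧
      (y = v → ∀ a, Γ.parent v = some a → ReflTransGen (pEdge (newP Γ.parent v w)) x a) := by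
    intro x y h hx
    induction h with
    | refl => exact ⟨fun _ => .refl, fun h => absurd h hx⟩
    | @tail b c hxb hbc ih =>
      simp only [pEdge] at hbc
      constructor
      · intro hc
        by_cases hb : b = v
        · subst hb
          obtain ⟨a, ha⟩ : ∃ a, Γ.parent b = some a := by
            rcases ReflTransGen.cases_tail hxb with h | ⟨d, hd, hdb⟩
            · exact absurd h.symm hx
            · exact ⟨d, hdb⟩
          have h1 := ih.2 rfl a ha
          by_cases hcw : c = w
          · subst hcw
            refine (h1.tail (b := a) (c := b) ?_).tail ?_
            · simp [pEdge, newP, hvw, hbc, ha]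
            · simp [pEdge, newP]
          · refine h1.tail ?_
            simp [pEdge, newP, hcw, hc, hbc, ha]
        · have h1 := ih.1 hb
          by_cases hcw : c = w
          · subst hcw
            refine (h1.tail (b := b) (c := v) ?_).tail ?_
            · simp [pEdge, newP, hvw, hbc, hb]
            · simp [pEdge, newP]
          · refine h1.tail ?_
            simp [pEdge, newP, hcw, hc, hbc, hb]
      · rintro rfl a ha
        rw [hbc] at ha
        cases ha
        exact ih.1 (fun h => hself _ (h ▸ hbc))
  have hvw' : ReflTransGen (pEdge (newP Γ.parent v w)) v w :=
    .single (by simp [pEdge, newP])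
  constructor
  · intro h
    induction h with
    | refl => 
      by_cases hx : x = v
      · exact Or.inr (Or.inr ⟨hx, Or.inl hx⟩)
      · exact Or.inl ⟨hx, hx, .refl⟩
    | @tail b c hxb hbc ih =>
      have r : ReflTransGen (pEdge Γ.parent) w w := .refl
      simp only [pEdge, newP] at hbc
      split_ifs at hbc with h1 h2 h3 h4
      · cases hbc; grind
      · have := step b v w (step b b v .refl hbc) h3
        have h5 : ReflTransGen (pEdge Γ.parent) b v := step b b v .refl hbc
        have := ReflTransGen.trans (a := x) (b := b) (c := w)  (r := pEdge Γ.parent)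
        have := ReflTransGen.trans (a := w) (b := b) (c := v)  (r := pEdge Γ.parent)
        have := ReflTransGen.trans (a := x) (b := b) (c := v)  (r := pEdge Γ.parent)
        grind
      · have := step b b w .refl hbc
        have := hself w
        have := pE_antisymm Γ (x := w) (y := b)
        have := ReflTransGen.trans (a := x) (b := b) (c := w)  (r := pEdge Γ.parent)
        grind
      · have := step b v c (step b b v .refl hbc) h4
        have h5 : ReflTransGen (pEdge Γ.parent) b v := step b b v .refl hbc
        have := hself v
        have := ReflTransGen.trans (a := x) (b := b) (c := c)  (r := pEdge Γ.parent)
        have := ReflTransGen.trans (a := w) (b := b) (c := v)  (r := pEdge Γ.parent)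
        grind
      · have := step x b c
        have := step w b c
        grind
  · rintro (⟨hx, hy, h⟩ | ⟨hx, rfl, hxw, h⟩ | ⟨rfl, rfl | h⟩)
    · exact (A1 x y h hx).1 hy
    · have h1 := (A1 x w h hx).1 hvw.symm
      rcases ReflTransGen.cases_tail h1 with h | ⟨d, hd, hdb⟩
      · exact absurd h.symm hxw
      · simp [pEdge, newP] at hdb
        subst hdb; exact hd
    · exact .refl
    · exact hvw'.trans ((A1 w y h hvw.symm).1 (fun e => hwv (e ▸ h)))

/-- the modified tree-extension -/
theorem exists_new {V : Type*} [Fintype V] {E : V → V → Prop} (hdag : IsDAG E) (Γ : TreeExt E)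
    {u v w : V} (hu : ∀ x, E x v ↔ x = u) (hw : ∀ x, E v x ↔ x = w) :
    ∃ Γ' : TreeExt E, Γ'.parent = newP Γ.parent v w ∧ nswTE Γ' ≤ nswTE Γ := by
  have huv : u ≠ v := by
    rintro rfl; exact hdag u (.single ((hu u).2 rfl))
  have hvw : v ≠ w := by
    rintro rfl; exact hdag v (.single ((hw v).2 rfl))
  have hRvw := Γ.extends_edges v w ((hw w).2 rfl)
  have hRuv := Γ.extends_edges u v ((hu u).2 rfl)
  have huw : u ≠ w := by
    rintro rfl; exact huv (pE_antisymm Γ hRuv hRvw)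
  have hrt : ∀ a, ReflTransGen (pEdge Γ.parent) a Γ.root → a = Γ.root := fun a h =>
    pE_antisymm Γ h (Γ.reach_root a)
  have hrv : Γ.root ≠ v := fun h => huv ((hrt u (h ▸ hRuv)).trans h)
  have hrw : Γ.root ≠ w := fun h => hvw ((hrt v (h ▸ hRvw)).trans h)
  have iff := newP_iff Γ hvw hRvw
  refine ⟨⟨newP Γ.parent v w, Γ.root, ?_, ?_, ?_⟩, rfl, ?_⟩
  · simp [newP, hrv, hrw, Γ.root_parent]
  · intro y
    rw [iff]
    have := Γ.reach_root y
    have := Γ.reach_root w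
    grind
  · intro a b hab
    rw [iff]
    have := Γ.extends_edges a b hab
    have := hRuv.trans hRvw
    have := hu a
    have := hw b
    have r : ReflTransGen (pEdge Γ.parent) w w := .refl
    grind
  · generalize hΓ' : (TreeExt.mk (E := E) (newP Γ.parent v w) Γ.root _ _ _) = Γ'
    have hp : Γ'.parent = newP Γ.parent v w := by rw [← hΓ']
    have hD : ∀ x y, y ∈ descend Γ' x ↔
        (x ≠ v ∧ y ≠ v ∧ ReflTransGen (pEdge Γ.parent) x y) ∨
        (x ≠ v ∧ y = v ∧ x ≠ w ∧ ReflTransGen (pEdge Γ.parent) x w) ∨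
        (x = v ∧ (y = v ∨ ReflTransGen (pEdge Γ.parent) w y)) := fun x y => by
      rw [descend, hp]; exact (iff x y)
    have hle : ∀ z, (nodeBag Γ z).ncard ≤ nswTE Γ := fun z =>
      Finset.le_sup (f := fun v : V => (nodeBag Γ v).ncard) (Finset.mem_univ z)
    have big : ∀ x z, descend Γ' x = insert v (descend Γ z) → v ∉ descend Γ z →
        w ∈ descend Γ z → (nodeBag Γ' x).ncard ≤ nswTE Γ := by
      intro x z h1 h2 h3
      have hv : v ∈ nodeBag Γ z := ⟨h2, w, h3, (hw w).2 rfl⟩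
      have hsub : nodeBag Γ' x ⊆ insert u (nodeBag Γ z \ {v}) := by
        rintro a ⟨ha, b, hb, hab⟩
        rw [h1] at ha hb
        rcases hb with rfl | hb
        · exact Or.inl ((hu a).1 hab)
        · refine Or.inr ⟨⟨fun h => ha (Or.inr h), b, hb, hab⟩, fun h => ha (Or.inl h)⟩
      have c1 := Set.ncard_le_ncard hsub (Set.toFinite _)
      have c2 := Set.ncard_insert_le u (nodeBag Γ z \ {v})
      have c3 := Set.ncard_sdiff_singleton_add_one hv (Set.toFinite _)
      have := hle z
      omega
    refine Finset.sup_le fun x _ => ?_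
    have hwv : ¬ ReflTransGen (pEdge Γ.parent) w v := fun h => hvw (pE_antisymm Γ hRvw h)
    by_cases hxv : x = v
    · subst hxv
      refine big x w ?_ hwv .refl
      ext y
      rw [hD]
      simp only [Set.mem_insert_iff, descend, Set.mem_ofPred_eq]
      grind
    · by_cases hx : ReflTransGen (pEdge Γ.parent) v x ∧ ReflTransGen (pEdge Γ.parent) x w ∧ x ≠ w
      · obtain ⟨a1, a2, a3⟩ := hx
        have a4 : ¬ ReflTransGen (pEdge Γ.parent) x v := fun h => hxv (pE_antisymm Γ h a1)
        refine big x x ?_ a4 a2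
        ext y
        rw [hD]
        simp only [Set.mem_insert_iff, descend, Set.mem_ofPred_eq]
        grind
      · have : descend Γ' x = descend Γ x := by
          ext y
          rw [hD]
          simp only [descend, Set.mem_ofPred_eq]
          have t1 := fun h => pE_total (x := x) (y := v) (z := w) (p := Γ.parent) h hRvw
          have t2 : ReflTransGen (pEdge Γ.parent) x v → ReflTransGen (pEdge Γ.parent) x w :=
            fun h => h.trans hRvw
          grind
        have e : nodeBag Γ' x = nodeBag Γ x := by
          simp only [nodeBag, this]
        rw [e]
        exact hle x

/-- Let `v` be a chain vertex of a finite DAG `G` (in-degree 1 and out-degree 1) with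
unique child `w`. Then there is an optimal tree-extension `Γ` of `G` in which `w` is the
only child of `v`, and which satisfies `GW(v,Γ) ⊆ GW(w,Γ) ∪ parents(v)` and
`GW(w,Γ) ⊆ GW(v,Γ) ∪ parents(w)`. -/
theorem stmt2 {V : Type*} [Fintype V] [Nonempty V] (E : V → V → Prop) (hdag : IsDAG E)
    (v w : V) (hin : (parentsOf E v).ncard = 1) (hout : {x : V | E v x} = {w}) :
    ∃ Γ : TreeExt E, nswTE Γ = nsw E ∧
      Γ.parent w = some v ∧ (∀ x : V, Γ.parent x = some v → x = w) ∧
      nodeBag Γ v ⊆ nodeBag Γ w ∪ parentsOf E v ∧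
      nodeBag Γ w ⊆ nodeBag Γ v ∪ parentsOf E w := by
  classical
  obtain ⟨u, hu⟩ := Set.ncard_eq_one.1 hin
  have hu' : ∀ x, E x v ↔ x = u := fun x => by
    have := Set.ext_iff.1 hu x
    simpa [parentsOf] using this
  have hw : ∀ x, E v x ↔ x = w := fun x => by
    have := Set.ext_iff.1 hout x
    simpa using this
  have hne : {n : ℕ | ∃ Γ : TreeExt E, nswTE Γ = n}.Nonempty := by
    obtain ⟨Γ⟩ := exists_treeExt_s2 E hdag
    exact ⟨_, Γ, rfl⟩
  obtain ⟨Γ, hΓ⟩ := Nat.sInf_mem hne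
  have hvw : v ≠ w := by
    rintro rfl; exact hdag v (.single ((hw v).2 rfl))
  have hself : ∀ a, Γ.parent a ≠ some a := fun a h =>
    pE_acyc Γ a (TransGen.single (show pEdge _ _ _ from h))
  have hRvw := Γ.extends_edges v w ((hw w).2 rfl)
  obtain ⟨Γ', hp, hle⟩ := exists_new hdag Γ hu' hw
  have hpw : Γ'.parent w = some v := by simp [hp, newP]
  have hch : ∀ x, Γ'.parent x = some v → x = w := by
    intro x hx
    by_contra hxw
    rw [hp] at hx
    simp only [newP, hxw, if_false] at hx
    have := hself v
    grind
  have hDv : ∀ y, y ∈ descend Γ' v ↔ y = v ∨ y ∈ descend Γ' w := by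
    intro y
    constructor
    · intro h
      rcases ReflTransGen.cases_head h with h | ⟨c, hc, h⟩
      · exact Or.inl h.symm
      · rw [hch c hc] at h
        exact Or.inr h
    · rintro (rfl | h)
      · exact ReflTransGen.refl
      · exact ReflTransGen.head (show pEdge Γ'.parent v w from hpw) h
  refine ⟨Γ', le_antisymm (hle.trans hΓ.le) (Nat.sInf_le ⟨Γ', rfl⟩), hpw, hch, ?_, ?_⟩
  · rintro a ⟨ha, b, hb, hab⟩
    rcases (hDv b).1 hb with rfl | hb
    · exact Or.inr hab
    · exact Or.inl ⟨fun h => ha ((hDv a).2 (Or.inr h)), b, hb, hab⟩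
  · rintro a ⟨ha, b, hb, hab⟩
    by_cases hav : a = v
    · subst hav
      exact Or.inr ((hw w).2 rfl)
    · refine Or.inl ⟨fun h => ?_, b, (hDv b).2 (Or.inr hb), hab⟩
      rcases (hDv a).1 h with h | h
      · exact hav h
      · exact ha h
end

section
/- Let G be a finite directed acyclic graph whose underlying undirected graph is biconnected and which has exactly one reticulation r (a vertex of in-degree at least 2); G may have several vertices of in-degree 0. Then nsw(G) equals the in-degree of r, and the directed path whose vertices are V(G) listed in any topological order of G is an optimal tree-extension of G. -/
/-- The underlying undirected (simple) graph of a digraph. -/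
def underlyingGraph {V : Type*} (E : V → V → Prop) : SimpleGraph V := SimpleGraph.fromRel E

/-- A simple graph is biconnected if it is connected and stays connected after removing
any single vertex. -/
def Biconnected {V : Type*} (G : SimpleGraph V) : Prop :=
  G.Connected ∧ ∀ x : V, (G.induce {y : V | y ≠ x}).Connected

/-- The parent function of the directed path listing the vertices of `V` in the order
given by the enumeration `σ : Fin n ≃ V`. -/
def pathParent {V : Type*} {n : ℕ} (σ : Fin n ≃ V) : V → Option V :=
  fun v =>
    if _h : (σ.symm v : ℕ) = 0 then none
    else some (σ ⟨(σ.symm v : ℕ) - 1, Nat.lt_of_le_of_lt (Nat.sub_le _ _) (σ.symm v).isLt⟩)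

open Relation in
theorem aux_no_cycle {V : Type*} {E : V → V → Prop} (Γ : TreeExt E) (v : V) :
    ¬ TransGen (pEdge Γ.parent) v v := by
  have h := Γ.reach_root v
  induction h with
  | refl =>
    intro h
    obtain ⟨m, _, hm⟩ := TransGen.tail'_iff.1 h
    have h2 := Γ.root_parent
    unfold pEdge at hm
    rw [h2] at hm
    cases hm
  | @tail b c _ hbc ih =>
    intro h
    obtain ⟨m, hcm, hm⟩ := TransGen.tail'_iff.1 h
    unfold pEdge at hm
    have hbc' := hbc
    unfold pEdge at hbc'
    rw [hbc'] at hm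
    cases hm
    exact ih (TransGen.head' hbc hcm)

open Relation in
theorem aux_lower {V : Type*} [Fintype V] {E : V → V → Prop} (hdag : IsDAG E) (r : V)
    (Γ : TreeExt E) : (parentsOf E r).ncard ≤ nswTE Γ := by
  have h1 : (parentsOf E r).ncard ≤ (nodeBag Γ r).ncard := by
    apply Set.ncard_le_ncard _ (Set.toFinite _)
    intro u hu
    refine ⟨fun hd => ?_, r, ReflTransGen.refl, hu⟩
    have hur := Γ.extends_edges u r hu
    rcases reflTransGen_iff_eq_or_transGen.1 hur with h | h
    · subst h
      exact hdag _ (TransGen.single hu)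
    · exact aux_no_cycle Γ r (TransGen.trans_right hd h)
  exact h1.trans (Finset.le_sup (f := fun v : V => (nodeBag Γ v).ncard) (Finset.mem_univ r))

theorem aux_par_unique {V : Type*} [Fintype V] {E : V → V → Prop} {r : V}
    (huniq : ∀ x : V, 2 ≤ (parentsOf E x).ncard → x = r) {x a b : V} (hx : x ≠ r)
    (ha : E a x) (hb : E b x) : a = b := by
  by_contra hab
  exact hx (huniq x ((Set.one_lt_ncard (Set.toFinite _)).2 ⟨a, ha, b, hb, hab⟩))

open Relation in
theorem aux_reach {V : Type*} [Fintype V] {E : V → V → Prop} (hdag : IsDAG E)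
    (hbic : Biconnected (underlyingGraph E))
    (r : V) (hret : 2 ≤ (parentsOf E r).ncard)
    (huniq : ∀ x : V, 2 ≤ (parentsOf E x).ncard → x = r) (x : V) : ReflTransGen E x r := by
  by_contra hx
  have hxr : x ≠ r := fun h => hx (h ▸ ReflTransGen.refl)
  obtain ⟨p, hpD, hp⟩ : ∃ p, ¬ ReflTransGen E x p ∧ ∀ u, E u x → u = p := by
    by_cases h : ∃ p, E p x
    · obtain ⟨p, hp⟩ := h
      exact ⟨p, fun h => hdag x (TransGen.tail' h hp), fun u hu => aux_par_unique huniq hxr hu hp⟩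
    · push Not at h
      exact ⟨r, hx, fun u hu => (h u hu).elim⟩
  obtain ⟨t, htr, htp⟩ : ∃ t, E t r ∧ t ≠ p := by
    obtain ⟨a, ha, b, hb, hab⟩ := (Set.one_lt_ncard (Set.toFinite _)).1 hret
    by_cases h : a = p
    · exact ⟨b, hb, fun h' => hab (h.trans h'.symm)⟩
    · exact ⟨a, ha, h⟩
  have hxp : x ≠ p := fun h => hpD (h ▸ ReflTransGen.refl)
  obtain ⟨w⟩ := (hbic.2 p).preconnected ⟨x, hxp⟩ ⟨t, htp⟩
  have key : ∀ (a b : {y : V | y ≠ p}), ((underlyingGraph E).induce {y : V | y ≠ p}).Walk a b →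
      ReflTransGen E x a → ReflTransGen E x b := by
    intro a b w
    induction w with
    | nil => exact id
    | @cons u v _ hadj _ ih =>
      intro hu
      apply ih
      have h1 : (underlyingGraph E).Adj u v := hadj
      unfold underlyingGraph at h1
      rw [SimpleGraph.fromRel_adj] at h1
      rcases h1.2 with h | h
      · exact hu.tail h
      · rcases ReflTransGen.cases_tail hu with h' | ⟨m, hm, hmu⟩
        · rw [h'] at h
          exact (v.2 (hp _ h)).elim
        · have hur : (u : V) ≠ r := fun h => hx (h ▸ hu)
          rw [aux_par_unique huniq hur h hmu]
          exact hm
  exact hx ((key _ _ w ReflTransGen.refl).tail htr)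

open Relation in
theorem aux_total {V : Type*} [Fintype V] {E : V → V → Prop} (hdag : IsDAG E) {r : V}
    (huniq : ∀ x : V, 2 ≤ (parentsOf E x).ncard → x = r) {a b q : V}
    (hq : TransGen E q r) (ha : ReflTransGen E a q) (hb : ReflTransGen E b q) :
    ReflTransGen E a b ∨ ReflTransGen E b a := by
  induction ha with
  | refl => exact Or.inr hb
  | @tail m q ham hmq ih =>
    rcases ReflTransGen.cases_tail hb with h' | ⟨m', hm, hmu⟩
    · subst h'
      exact Or.inl (ham.tail hmq)
    · have hqr : q ≠ r := fun h => hdag r (h ▸ hq)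
      have := aux_par_unique huniq hqr hmq hmu
      subst this
      exact ih (TransGen.head hmq hq) hm

open Relation in
theorem aux_inj {V : Type*} [Fintype V] {E : V → V → Prop} (hdag : IsDAG E) {r : V}
    (huniq : ∀ x : V, 2 ≤ (parentsOf E x).ncard → x = r) (T : Set V)
    (hT : ∀ a b, a ∈ T → ReflTransGen E a b → b ∈ T) {u₁ u₂ w₁ w₂ q : V}
    (hu2 : u₂ ∉ T) (hw1 : w₁ ∈ T) (e1 : E u₁ w₁) (e2 : E u₂ w₂)
    (hq : E q r) (h2 : ReflTransGen E w₂ q) 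
    (h : ReflTransGen E w₁ w₂) : u₁ = u₂ := by
  have hw2r : w₂ ≠ r := fun h => hdag r (TransGen.tail' (h ▸ h2) hq)
  rcases ReflTransGen.cases_tail h with h' | ⟨m, hm, hmu⟩
  · subst h'
    exact aux_par_unique huniq hw2r e1 e2
  · have := aux_par_unique huniq hw2r hmu e2
    subst this
    exact (hu2 (hT _ _ hw1 hm)).elim

open Relation in
theorem aux_bag {V : Type*} [Fintype V] {E : V → V → Prop} (hdag : IsDAG E)
    (hbic : Biconnected (underlyingGraph E))
    (r : V) (hret : 2 ≤ (parentsOf E r).ncard)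
    (huniq : ∀ x : V, 2 ≤ (parentsOf E x).ncard → x = r) (T : Set V)
    (hT : ∀ a b, a ∈ T → ReflTransGen E a b → b ∈ T) :
    {u | u ∉ T ∧ ∃ w ∈ T, E u w}.ncard ≤ (parentsOf E r).ncard := by
  have hf : ∀ u, ∃ q, (u ∉ T ∧ ∃ w ∈ T, E u w) → E q r ∧
      (q = u ∨ ∃ w ∈ T, E u w ∧ ReflTransGen E w q) := by
    intro u
    by_cases h : u ∉ T ∧ ∃ w ∈ T, E u w
    · obtain ⟨hu, w, hw, huw⟩ := h
      rcases ReflTransGen.cases_tail (aux_reach hdag hbic r hret huniq w) with h' | ⟨m, hm, hmu⟩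
      · subst h'
        exact ⟨u, fun _ => ⟨huw, Or.inl rfl⟩⟩
      · exact ⟨m, fun _ => ⟨hmu, Or.inr ⟨w, hw, huw, hm⟩⟩⟩
    · exact ⟨u, fun h' => (h h').elim⟩
  choose f hf using hf
  apply Set.ncard_le_ncard_of_injOn f (fun u hu => (hf u hu).1) _ (Set.toFinite _)
  intro u₁ h₁ u₂ h₂ heq
  obtain ⟨q1, c1⟩ := hf u₁ h₁
  obtain ⟨q2, c2⟩ := hf u₂ h₂
  rw [← heq] at c2
  rcases c1 with c1 | ⟨w₁, hw1, e1, r1⟩ <;> rcases c2 with c2 | ⟨w₂, hw2, e2, r2⟩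
  · exact c1.symm.trans c2
  · exact (h₁.1 (c1 ▸ hT _ _ hw2 r2)).elim
  · exact (h₂.1 (c2 ▸ hT _ _ hw1 r1)).elim
  · rcases aux_total hdag huniq (TransGen.single q1) r1 r2 with h | h
    · exact aux_inj hdag huniq T hT h₂.1 hw1 e1 e2 q1 r2 h
    · exact (aux_inj hdag huniq T hT h₁.1 hw2 e2 e1 q1 r1 h).symm

open Relation in
theorem aux_path {V : Type*} {n : ℕ} (σ : Fin n ≃ V) (i j : Fin n) :
    ReflTransGen (pEdge (pathParent σ)) (σ i) (σ j) ↔ i ≤ j := by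
  constructor
  · intro h
    have : ∀ w, ReflTransGen (pEdge (pathParent σ)) (σ i) w → i ≤ σ.symm w := by
      intro w hw
      induction hw with
      | refl => simp
      | @tail b c _ hbc ih =>
        unfold pEdge pathParent at hbc
        split_ifs at hbc with h0
        have hb := Option.some.inj hbc
        rw [← hb, Equiv.symm_apply_apply] at ih
        rw [Fin.le_def] at ih ⊢
        simp only at ih
        omega
    simpa using this _ h
  · obtain ⟨j, hj⟩ := j
    intro h
    induction j with
    | zero =>
      have : i = ⟨0, hj⟩ := le_antisymm h (Fin.le_def.2 (Nat.zero_le _))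
      rw [this]
    | succ k ih =>
      by_cases hk : (i : ℕ) = k + 1
      · have : i = ⟨k + 1, hj⟩ := Fin.ext hk
        rw [this]
      · have hle : (i : ℕ) ≤ k + 1 := h
        refine (ih (by omega) (Fin.le_def.2 (by simp only; omega))).tail ?_
        simp [pEdge, pathParent]

/-- Let `G` be a finite DAG whose underlying undirected graph is biconnected and which
has exactly one reticulation `r` (vertex of in-degree at least 2). Then `nsw(G)` equals
the in-degree of `r`, and the directed path listing `V(G)` in any topological order is an
optimal tree-extension of `G`. -/
theorem stmt5 {V : Type*} [Fintype V] (E : V → V → Prop) (hdag : IsDAG E)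
    (hbic : Biconnected (underlyingGraph E))
    (r : V) (hret : 2 ≤ (parentsOf E r).ncard)
    (huniq : ∀ x : V, 2 ≤ (parentsOf E x).ncard → x = r)
    {n : ℕ} (σ : Fin n ≃ V) (htopo : ∀ i j : Fin n, E (σ i) (σ j) → i < j) :
    nsw E = (parentsOf E r).ncard ∧
    ∃ Γ : TreeExt E, Γ.parent = pathParent σ ∧ nswTE Γ = nsw E := by
  have hn : 0 < n := Fin.pos (σ.symm r)
  have hp : ∀ u v : V, Relation.ReflTransGen (pEdge (pathParent σ)) u v ↔ σ.symm u ≤ σ.symm v := by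
    intro u v
    have := aux_path σ (σ.symm u) (σ.symm v)
    simpa using this
  have hE : ∀ u v : V, E u v → σ.symm u ≤ σ.symm v := fun u v h =>
    (htopo (σ.symm u) (σ.symm v) (by simpa using h)).le
  let Γ : TreeExt E :=
    { parent := pathParent σ
      root := σ ⟨0, hn⟩
      root_parent := by simp [pathParent]
      reach_root := fun v => (hp _ _).2 (by simp [Fin.le_def])
      extends_edges := fun u v h => (hp _ _).2 (hE u v h) }
  have hle : nswTE Γ ≤ (parentsOf E r).ncard := by
    refine Finset.sup_le fun v _ => ?_
    refine aux_bag hdag hbic r hret huniq (descend Γ v) ?_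
    intro a b ha hab
    have ha' : σ.symm v ≤ σ.symm a := (hp _ _).1 ha
    refine (hp _ _).2 ?_
    induction hab with
    | refl => exact ha'
    | tail _ h ih => exact ih.trans (hE _ _ h)
  have heq : nswTE Γ = (parentsOf E r).ncard := le_antisymm hle (aux_lower hdag r Γ)
  have hnsw : nsw E = (parentsOf E r).ncard := by
    apply le_antisymm
    · exact Nat.sInf_le ⟨Γ, heq⟩
    · refine le_csInf ⟨_, Γ, rfl⟩ ?_
      rintro m ⟨Γ', rfl⟩
      exact aux_lower hdag r Γ'
  exact ⟨hnsw, Γ, rfl, heq.trans hnsw.symm⟩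
end

section
/- Let N = (V,E,ω) be a phylogenetic network on taxa X. For every A ⊆ X: (i) the set anc(A) of all ancestors of the leaves labeled by A is feasible, and ω_Σ(anc(A)) = PD^map_N(A); and (ii) for every feasible set Z ⊆ V, ω_Σ(Z) ≤ PD^map_N(Z ∩ X), where Z ∩ X denotes the set of taxa labeling the leaves in Z. -/
/-- A (rooted, edge-weighted) phylogenetic network on a finite vertex type `V` with taxa
`X`: a weakly connected DAG with a unique root of in-degree 0 and out-degree at least 2;
leaves (vertices of out-degree 0) have in-degree 1 and are bijectively labeled by `X`
via `lab`; every other vertex is a tree vertex (in-degree 1, out-degree ≥ 2) or a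
reticulation vertex (in-degree 2, out-degree 1); `ω` assigns a natural-number weight to
each edge. -/
structure PhyloNet (V : Type*) (X : Type*) [Fintype V] where
  E : V → V → Prop
  ω : V → V → ℕ
  acyclic : ∀ v : V, ¬ Relation.TransGen E v v
  connected : (SimpleGraph.fromRel E).Connected
  root : V
  root_no_parent : ∀ u : V, ¬ E u root
  root_outdeg : 2 ≤ ({w : V | E root w}).ncard
  lab : X → V
  lab_inj : Function.Injective lab
  lab_leaves : ∀ v : V, ({w : V | E v w} = ∅ ↔ ∃ x : X, lab x = v)
  leaf_indeg : ∀ x : X, ({u : V | E u (lab x)}).ncard = 1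
  internal : ∀ v : V, v ≠ root → {w : V | E v w} ≠ ∅ →
      ({u : V | E u v}.ncard = 1 ∧ 2 ≤ {w : V | E v w}.ncard) ∨
      ({u : V | E u v}.ncard = 2 ∧ {w : V | E v w}.ncard = 1)

/-- The total `ω`-weight of a set of (pairs encoding) edges. -/
noncomputable def wSum {V X : Type*} [Fintype V] (N : PhyloNet V X)
    (F : Set (V × V)) : ℕ :=
  ∑ p ∈ (Set.toFinite F).toFinset, N.ω p.1 p.2

/-- The edge `p` has offspring in `A ⊆ X`: it is an edge of `N` whose head is an ancestor
of some leaf labeled by an element of `A`. -/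
def HasOffspring {V X : Type*} [Fintype V] (N : PhyloNet V X) (A : Set X)
    (p : V × V) : Prop :=
  N.E p.1 p.2 ∧ ∃ x ∈ A, Relation.ReflTransGen N.E p.2 (N.lab x)

/-- All-paths phylogenetic diversity: the total weight of all edges with offspring in `A`. -/
noncomputable def PDmap {V X : Type*} [Fintype V] (N : PhyloNet V X) (A : Set X) : ℕ :=
  wSum N {p : V × V | HasOffspring N A p}

/-- The set of ancestors of the leaves labeled by elements of `A`. -/
def ancOf {V X : Type*} [Fintype V] (N : PhyloNet V X) (A : Set X) : Set V :=
  {u : V | ∃ x ∈ A, Relation.ReflTransGen N.E u (N.lab x)}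

/-- A set `Z ⊆ V` is feasible if each of its elements is a leaf or has a child in `Z`. -/
def Feasible {V X : Type*} [Fintype V] (N : PhyloNet V X) (Z : Set V) : Prop :=
  ∀ z ∈ Z, (∃ x : X, N.lab x = z) ∨ ∃ w ∈ Z, N.E z w

/-- `ω_Σ(Z)`: the total weight of all incoming edges at vertices of `Z`. -/
noncomputable def omegaSigma {V X : Type*} [Fintype V] (N : PhyloNet V X)
    (Z : Set V) : ℕ :=
  wSum N {p : V × V | N.E p.1 p.2 ∧ p.2 ∈ Z}

/-- For every phylogenetic network `N` on taxa `X` and every `A ⊆ X`: (i) the set of all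
ancestors of the leaves labeled by `A` is feasible and its `ω_Σ`-value is `PD^map_N(A)`;
(ii) for every feasible set `Z ⊆ V`, `ω_Σ(Z) ≤ PD^map_N(Z ∩ X)`. -/
theorem stmt11 {V X : Type*} [Fintype V] (N : PhyloNet V X) (A : Set X) :
    (Feasible N (ancOf N A) ∧ omegaSigma N (ancOf N A) = PDmap N A) ∧
    (∀ Z : Set V, Feasible N Z → omegaSigma N Z ≤ PDmap N {x : X | N.lab x ∈ Z}) := by
  refine ⟨⟨?_, rfl⟩, ?_⟩
  · rintro z ⟨x, hx, h⟩
    rcases Relation.ReflTransGen.cases_head h with h | ⟨w, hw, h⟩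
    · exact Or.inl ⟨x, h.symm⟩
    · exact Or.inr ⟨w, ⟨x, hx, h⟩, hw⟩
  · intro Z hZ
    have wf : WellFounded (fun a b : V => Relation.TransGen N.E b a) := by
      haveI : IsTrans V (fun a b : V => Relation.TransGen N.E b a) :=
        ⟨fun _ _ _ h1 h2 => Relation.TransGen.trans h2 h1⟩
      haveI : Std.Irrefl (fun a b : V => Relation.TransGen N.E b a) :=
        ⟨fun a h => N.acyclic a h⟩
      exact Finite.wellFounded_of_trans_of_irrefl _
    have key : ∀ z : V, z ∈ Z →
        ∃ x : X, N.lab x ∈ Z ∧ Relation.ReflTransGen N.E z (N.lab x) := by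
      intro z
      induction z using wf.induction with
      | _ z ih =>
        intro hz
        rcases hZ z hz with ⟨x, rfl⟩ | ⟨w, hw, hE⟩
        · exact ⟨x, hz, Relation.ReflTransGen.refl⟩
        · obtain ⟨x, hx, h⟩ := ih w (Relation.TransGen.single hE) hw
          exact ⟨x, hx, Relation.ReflTransGen.head hE h⟩
    unfold omegaSigma PDmap wSum
    apply Finset.sum_le_sum_of_subset
    rw [Set.Finite.toFinset_subset_toFinset]
    rintro p ⟨hp, hz⟩
    exact ⟨hp, key _ hz⟩
end

section
/- Let N = (V,E,ω) be a phylogenetic network on taxa X, let c : X → ℕ be a cost function, and let B ∈ ℕ be a budget. Then the maximum of PD^map_N(A) over all A ⊆ X with c_Σ(A) ≤ B equals the maximum of ω_Σ(Z) over all feasible sets Z ⊆ V with c_Σ(Z ∩ X) ≤ B, where Z ∩ X denotes the set of taxa labeling the leaves in Z. -/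
/-- The total cost of a set of taxa. -/
noncomputable def costSum {X : Type*} [Finite X] (c : X → ℕ) (A : Set X) : ℕ :=
  ∑ x ∈ (Set.toFinite A).toFinset, c x

theorem wSum_mono_aux {V X : Type*} [Fintype V] (N : PhyloNet V X)
    {F G : Set (V × V)} (h : F ⊆ G) : wSum N F ≤ wSum N G := by
  unfold wSum
  apply Finset.sum_le_sum_of_subset
  intro p hp
  simp only [Set.Finite.mem_toFinset] at hp ⊢
  exact h hp

theorem feas_reach_aux {V X : Type*} [Fintype V] (N : PhyloNet V X)
    (Z : Set V) (hZ : Feasible N Z) (v : V) (hv : v ∈ Z) :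
    ∃ x ∈ {x : X | N.lab x ∈ Z}, Relation.ReflTransGen N.E v (N.lab x) := by
  have hwf : WellFounded (fun a b : V => Relation.TransGen N.E b a) := by
    have : IsTrans V (fun a b : V => Relation.TransGen N.E b a) :=
      ⟨fun a b c h1 h2 => h2.trans h1⟩
    have : Std.Irrefl (fun a b : V => Relation.TransGen N.E b a) :=
      ⟨fun a => N.acyclic a⟩
    exact Finite.wellFounded_of_trans_of_irrefl _
  induction v using hwf.induction with
  | _ v ih =>
    rcases hZ v hv with ⟨x, rfl⟩ | ⟨w, hw, hE⟩
    · exact ⟨x, hv, Relation.ReflTransGen.refl⟩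
    · obtain ⟨x, hx, hr⟩ := ih w (Relation.TransGen.single hE) hw
      exact ⟨x, hx, Relation.ReflTransGen.head hE hr⟩

theorem leaf_reach_aux {V X : Type*} [Fintype V] (N : PhyloNet V X)
    (x y : X) (h : Relation.ReflTransGen N.E (N.lab x) (N.lab y)) : x = y := by
  rcases Relation.ReflTransGen.cases_head h with h | ⟨w, hw, _⟩
  · exact N.lab_inj h
  · have := (N.lab_leaves (N.lab x)).2 ⟨x, rfl⟩
    exact absurd (show w ∈ {w : V | N.E (N.lab x) w} from hw) (by rw [this]; simp)

/-- For a phylogenetic network `N` on taxa `X`, costs `c` and budget `B`, the maximum of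
`PD^map_N(A)` over all `A ⊆ X` with `c_Σ(A) ≤ B` equals the maximum of `ω_Σ(Z)` over all
feasible sets `Z ⊆ V` with `c_Σ(Z ∩ X) ≤ B`. -/
theorem stmt12 {V X : Type*} [Fintype V] [Fintype X] (N : PhyloNet V X)
    (c : X → ℕ) (B : ℕ) :
    sSup {n : ℕ | ∃ A : Set X, costSum c A ≤ B ∧ PDmap N A = n} =
    sSup {n : ℕ | ∃ Z : Set V, Feasible N Z ∧
      costSum c {x : X | N.lab x ∈ Z} ≤ B ∧ omegaSigma N Z = n} := by
  have hbd : ∀ F : Set (V × V), wSum N F ≤ wSum N Set.univ :=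
    fun F => wSum_mono_aux N (Set.subset_univ F)
  have h0 : costSum c (∅ : Set X) ≤ B := by simp [costSum]
  apply le_antisymm
  · apply csSup_le
    · exact ⟨_, ∅, h0, rfl⟩
    · rintro n ⟨A, hA, rfl⟩
      apply le_csSup
      · refine ⟨wSum N Set.univ, ?_⟩
        rintro n ⟨Z, _, _, rfl⟩
        exact hbd _
      · refine ⟨{v | ∃ x ∈ A, Relation.ReflTransGen N.E v (N.lab x)}, ?_, ?_, rfl⟩
        · rintro z ⟨x, hx, hr⟩
          rcases Relation.ReflTransGen.cases_head hr with h | ⟨w, hw, hr'⟩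
          · exact Or.inl ⟨x, h.symm⟩
          · exact Or.inr ⟨w, ⟨x, hx, hr'⟩, hw⟩
        · have : {y : X | N.lab y ∈ {v | ∃ x ∈ A, Relation.ReflTransGen N.E v (N.lab x)}} = A := by
            ext y
            constructor
            · rintro ⟨x, hx, hr⟩
              rw [leaf_reach_aux N y x hr]
              exact hx
            · intro hy
              exact ⟨y, hy, Relation.ReflTransGen.refl⟩
          rw [this]
          exact hA
  · apply csSup_le
    · refine ⟨_, ∅, ?_, ?_, rfl⟩
      · intro z hz
        exact absurd hz (by simp)
      · simp [costSum]
    · rintro n ⟨Z, hZ, hc, rfl⟩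
      have h1 : omegaSigma N Z ≤ PDmap N {x : X | N.lab x ∈ Z} := by
        apply wSum_mono_aux
        rintro p ⟨hp, hz⟩
        exact ⟨hp, feas_reach_aux N Z hZ _ hz⟩
      refine h1.trans (le_csSup ?_ ⟨_, hc, rfl⟩)
      refine ⟨wSum N Set.univ, ?_⟩
      rintro n ⟨A, _, rfl⟩
      exact hbd _
end

section
/- Let N = (V,E,ω) be a phylogenetic network on taxa X with root ρ. Then PD^min_N(X) equals the minimum of the total weight ∑_{e∈F} ω(e) over all nonempty edge sets F ⊆ E such that N[F] = (V(F), F) is a directed tree rooted at ρ whose set of leaves is exactly the set of leaves of N labeled by X. -/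
/-- `σ : V → V` is a switching of `N` if it selects, for every reticulation vertex `v`
(in-degree at least 2), one of its parents `σ v` (i.e. one of its incoming edges). -/
def IsSwitching {V X : Type*} [Fintype V] (N : PhyloNet V X) (σ : V → V) : Prop :=
  ∀ v : V, 2 ≤ ({u : V | N.E u v}).ncard → N.E (σ v) v

/-- The edge relation of the switching tree `T_σ`: all edges of `N` except the
reticulation edges not chosen by `σ`. -/
def switchEdge {V X : Type*} [Fintype V] (N : PhyloNet V X) (σ : V → V)
    (u v : V) : Prop :=
  N.E u v ∧ (2 ≤ ({u' : V | N.E u' v}).ncard → σ v = u)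

/-- The phylogenetic diversity of `A` in the switching tree `T_σ`: the total weight of
the edges of `T_σ` with offspring (within `T_σ`) in `A`. -/
noncomputable def PDswitch {V X : Type*} [Fintype V] (N : PhyloNet V X) (σ : V → V)
    (A : Set X) : ℕ :=
  wSum N {p : V × V | switchEdge N σ p.1 p.2 ∧
    ∃ x ∈ A, Relation.ReflTransGen (switchEdge N σ) p.2 (N.lab x)}

/-- Max-tree phylogenetic diversity: the maximum of `PD_{T_σ}(A)` over all switchings. -/
noncomputable def PDmax {V X : Type*} [Fintype V] (N : PhyloNet V X) (A : Set X) : ℕ :=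
  sSup {n : ℕ | ∃ σ : V → V, IsSwitching N σ ∧ PDswitch N σ A = n}

/-- Min-tree phylogenetic diversity: the minimum of `PD_{T_σ}(A)` over all switchings. -/
noncomputable def PDmin {V X : Type*} [Fintype V] (N : PhyloNet V X) (A : Set X) : ℕ :=
  sInf {n : ℕ | ∃ σ : V → V, IsSwitching N σ ∧ PDswitch N σ A = n}

/-- `V(F)`: the endpoints of a set of (pairs encoding) edges. -/
def VF {V : Type*} (F : Set (V × V)) : Set V :=
  {v : V | ∃ u : V, (u, v) ∈ F ∨ (v, u) ∈ F}

/-- `F` is the edge set of a directed tree rooted at the root of `N` inside `N`, whose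
set of leaves is exactly the set of leaves of `N` (those labeled by `X`): `F` is a
nonempty set of edges of `N`, every vertex has at most one incoming `F`-edge, the root
has none, every endpoint of `F` is reachable from the root along `F`, and the vertices of
`V(F)` without outgoing `F`-edge are precisely the labeled leaves of `N`. -/
def IsDisplayTreeEdges {V X : Type*} [Fintype V] (N : PhyloNet V X)
    (F : Set (V × V)) : Prop :=
  F.Nonempty ∧
  (∀ p ∈ F, N.E p.1 p.2) ∧
  (∀ v : V, Set.Subsingleton {u : V | (u, v) ∈ F}) ∧
  (∀ u : V, (u, N.root) ∉ F) ∧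
  (∀ v ∈ VF F, Relation.ReflTransGen (fun a b : V => (a, b) ∈ F) N.root v) ∧
  {v : V | v ∈ VF F ∧ {w : V | (v, w) ∈ F} = ∅} = Set.range N.lab

theorem aux_wf {V X : Type*} [Fintype V] (N : PhyloNet V X) : WellFounded N.E := by
  haveI : IsTrans V (Relation.TransGen N.E) := ⟨fun _ _ _ h h' => h.trans h'⟩
  haveI : Std.Irrefl (Relation.TransGen N.E) := ⟨N.acyclic⟩
  have := Finite.wellFounded_of_trans_of_irrefl (Relation.TransGen N.E)
  exact Subrelation.wf (fun h => Relation.TransGen.single h) this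

theorem aux_wf' {V X : Type*} [Fintype V] (N : PhyloNet V X) :
    WellFounded (fun a b => N.E b a) := by
  haveI : IsTrans V (fun a b => Relation.TransGen N.E b a) := ⟨fun _ _ _ h h' => h'.trans h⟩
  haveI : Std.Irrefl (fun a b => Relation.TransGen N.E b a) := ⟨N.acyclic⟩
  have := Finite.wellFounded_of_trans_of_irrefl (fun a b => Relation.TransGen N.E b a)
  exact Subrelation.wf (fun h => Relation.TransGen.single h) this

theorem aux_uniq {V X : Type*} [Fintype V] (N : PhyloNet V X) (σ : V → V) {u u' v : V}
    (h : switchEdge N σ u v) (h' : switchEdge N σ u' v) : u = u' := by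
  by_cases h2 : 2 ≤ ({u' : V | N.E u' v}).ncard
  · exact (h.2 h2).symm.trans (h'.2 h2)
  · have h1 : ({u' : V | N.E u' v}).ncard ≤ 1 := by omega
    exact (Set.ncard_le_one (Set.toFinite _)).1 h1 u h.1 u' h'.1

theorem aux_nonroot_parent {V X : Type*} [Fintype V] (N : PhyloNet V X) {v : V}
    (hv : v ≠ N.root) : ∃ u, N.E u v := by
  have : 0 < ({u : V | N.E u v}).ncard := by
    by_cases h : {w : V | N.E v w} = ∅
    · obtain ⟨x, rfl⟩ := (N.lab_leaves v).1 h
      rw [N.leaf_indeg x]; exact one_pos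
    · rcases N.internal v hv h with h | h <;> omega
  exact (Set.ncard_pos (Set.toFinite _)).1 this

theorem aux_switch_parent {V X : Type*} [Fintype V] (N : PhyloNet V X) {σ : V → V}
    (hσ : IsSwitching N σ) {v : V} (hv : v ≠ N.root) : ∃ u, switchEdge N σ u v := by
  by_cases h2 : 2 ≤ ({u' : V | N.E u' v}).ncard
  · exact ⟨σ v, hσ v h2, fun _ => rfl⟩
  · obtain ⟨u, hu⟩ := aux_nonroot_parent N hv
    exact ⟨u, hu, fun h => absurd h h2⟩

theorem aux_lab_ne_root {V X : Type*} [Fintype V] (N : PhyloNet V X) (x : X) :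
    N.lab x ≠ N.root := by
  intro h
  have h1 := (N.lab_leaves N.root).2 ⟨x, h⟩
  have h2 := N.root_outdeg
  rw [h1] at h2
  simp at h2

theorem aux_nonempty {V X : Type*} [Fintype V] (N : PhyloNet V X) : Nonempty X := by
  obtain ⟨m, -, hm⟩ := (aux_wf' N).has_min Set.univ ⟨N.root, trivial⟩
  have : {w : V | N.E m w} = ∅ := by
    ext w
    simpa using hm w trivial
  obtain ⟨x, -⟩ := (N.lab_leaves m).1 this
  exact ⟨x⟩

theorem aux_lab_no_child {V X : Type*} [Fintype V] (N : PhyloNet V X) (x : X) (w : V) :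
    ¬ N.E (N.lab x) w := by
  intro h
  have h1 := (N.lab_leaves (N.lab x)).2 ⟨x, rfl⟩
  have : w ∈ {w : V | N.E (N.lab x) w} := h
  rw [h1] at this
  exact this

theorem aux_forward {V X : Type*} [Fintype V] (N : PhyloNet V X) (σ : V → V)
    (hσ : IsSwitching N σ) :
    IsDisplayTreeEdges N {p : V × V | switchEdge N σ p.1 p.2 ∧
      ∃ x ∈ (Set.univ : Set X), Relation.ReflTransGen (switchEdge N σ) p.2 (N.lab x)} := by
  set F := {p : V × V | switchEdge N σ p.1 p.2 ∧
      ∃ x ∈ (Set.univ : Set X), Relation.ReflTransGen (switchEdge N σ) p.2 (N.lab x)} with hF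
  have hlab : ∀ x, ∃ u, (u, N.lab x) ∈ F := by
    intro x
    obtain ⟨u, hu⟩ := aux_switch_parent N hσ (aux_lab_ne_root N x)
    exact ⟨u, hu, x, trivial, .refl⟩
  have hreach : ∀ v : V, (∃ x, Relation.ReflTransGen (switchEdge N σ) v (N.lab x)) →
      Relation.ReflTransGen (fun a b : V => (a, b) ∈ F) N.root v := by
    intro v
    induction v using (aux_wf N).induction with
    | _ v ih =>
      rintro ⟨x, hx⟩
      by_cases hv : v = N.root
      · rw [hv]
      · obtain ⟨u, hu⟩ := aux_switch_parent N hσ hv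
        exact (ih u hu.1 ⟨x, .head hu hx⟩).tail ⟨hu, x, trivial, hx⟩
  have hVF : ∀ v ∈ VF F, ∃ x, Relation.ReflTransGen (switchEdge N σ) v (N.lab x) := by
    rintro v ⟨u, ⟨_, x, _, h⟩ | ⟨h1, x, _, h⟩⟩
    · exact ⟨x, h⟩
    · exact ⟨x, .head h1 h⟩
  refine ⟨?_, fun p hp => hp.1.1, fun v a ha b hb => aux_uniq N σ ha.1 hb.1,
    fun u hu => N.root_no_parent u hu.1.1, fun v hv => hreach v (hVF v hv), ?_⟩
  · obtain ⟨x⟩ := aux_nonempty N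
    obtain ⟨u, hu⟩ := hlab x
    exact ⟨_, hu⟩
  · ext v
    constructor
    · rintro ⟨hv, he⟩
      obtain ⟨x, hx⟩ := hVF v hv
      rcases hx.cases_head with h | ⟨c, hc, hcx⟩
      · exact ⟨x, h.symm⟩
      · have : c ∈ {w : V | (v, w) ∈ F} := ⟨hc, x, trivial, hcx⟩
        rw [he] at this
        exact this.elim
    · rintro ⟨x, rfl⟩
      obtain ⟨u, hu⟩ := hlab x
      refine ⟨⟨u, Or.inl hu⟩, ?_⟩
      ext w
      simp only [Set.mem_setOf_eq, Set.mem_empty_iff_false, iff_false]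
      intro h
      exact aux_lab_no_child N x w h.1.1

theorem aux_backward {V X : Type*} [Fintype V] (N : PhyloNet V X) (F : Set (V × V))
    (h : IsDisplayTreeEdges N F) : ∃ σ, IsSwitching N σ ∧
    {p : V × V | switchEdge N σ p.1 p.2 ∧
      ∃ x ∈ (Set.univ : Set X), Relation.ReflTransGen (switchEdge N σ) p.2 (N.lab x)} = F := by
  obtain ⟨-, hE, hsub, hroot, hreach, hleaf⟩ := h
  have hex : ∀ v, ∃ u, (2 ≤ ({u : V | N.E u v}).ncard → N.E u v) ∧
      ∀ u', (u', v) ∈ F → u = u' := by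
    intro v
    by_cases hv : ∃ u, (u, v) ∈ F
    · obtain ⟨u, hu⟩ := hv
      exact ⟨u, fun _ => hE _ hu, fun u' hu' => hsub v hu hu'⟩
    · push Not at hv
      by_cases hr : v = N.root
      · refine ⟨v, fun h2 => ?_, fun u' hu' => absurd hu' (hv u')⟩
        obtain ⟨u, hu⟩ := (Set.ncard_pos (Set.toFinite _)).1 (by omega :
          0 < ({u : V | N.E u v}).ncard)
        rw [hr] at hu
        exact absurd hu (N.root_no_parent u)
      · obtain ⟨u, hu⟩ := aux_nonroot_parent N hr
        exact ⟨u, fun _ => hu, fun u' hu' => absurd hu' (hv u')⟩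
  choose σ hσ1 hσ2 using hex
  refine ⟨σ, hσ1, ?_⟩
  have hsw : ∀ {u v}, (u, v) ∈ F → switchEdge N σ u v :=
    fun {u v} huv => ⟨hE _ huv, fun _ => hσ2 v u huv⟩
  have key : ∀ {u v}, v ∈ VF F → switchEdge N σ u v → (u, v) ∈ F := by
    intro u v hv huv
    rcases (hreach v hv).cases_tail with h | ⟨c, -, hc⟩
    · rw [h] at huv
      exact absurd huv.1 (N.root_no_parent u)
    · rw [aux_uniq N σ huv (hsw hc)]
      exact hc
  have hVF : ∀ x v, Relation.ReflTransGen (switchEdge N σ) v (N.lab x) → v ∈ VF F := by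
    intro x v hx
    induction hx using Relation.ReflTransGen.head_induction_on with
    | refl =>
      have : N.lab x ∈ Set.range N.lab := ⟨x, rfl⟩
      rw [← hleaf] at this
      exact this.1
    | head hab _ ih => exact ⟨_, Or.inr (key ih hab)⟩
  have hdown : ∀ v, v ∈ VF F → ∃ x, Relation.ReflTransGen (switchEdge N σ) v (N.lab x) := by
    intro v
    induction v using (aux_wf' N).induction with
    | _ v ih =>
      intro hv
      by_cases he : {w : V | (v, w) ∈ F} = ∅
      · have : v ∈ Set.range N.lab := by
          rw [← hleaf]
          exact ⟨hv, he⟩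
        obtain ⟨x, rfl⟩ := this
        exact ⟨x, .refl⟩
      · obtain ⟨w, hw⟩ := Set.nonempty_iff_ne_empty.2 he
        obtain ⟨x, hx⟩ := ih w (hE _ hw) ⟨v, Or.inl hw⟩
        exact ⟨x, .head (hsw hw) hx⟩
  ext ⟨u, v⟩
  constructor
  · rintro ⟨h1, x, -, hx⟩
    exact key (hVF x v hx) h1
  · intro huv
    obtain ⟨x, hx⟩ := hdown v ⟨u, Or.inl huv⟩
    exact ⟨hsw huv, x, trivial, hx⟩

/-- For a phylogenetic network `N` on taxa `X` with root `ρ`, `PD^min_N(X)` equals the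
minimum total weight `∑_{e ∈ F} ω(e)` over all nonempty edge sets `F ⊆ E` such that
`N[F]` is a directed tree rooted at `ρ` whose set of leaves is exactly the set of leaves
of `N` labeled by `X`. -/
theorem stmt14 {V X : Type*} [Fintype V] (N : PhyloNet V X) :
    PDmin N (Set.univ : Set X) =
    sInf {n : ℕ | ∃ F : Set (V × V), IsDisplayTreeEdges N F ∧ wSum N F = n} := by
  unfold PDmin
  congr 1
  ext n
  constructor
  · rintro ⟨σ, hσ, rfl⟩
    exact ⟨_, aux_forward N σ hσ, rfl⟩
  · rintro ⟨F, hF, rfl⟩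
    obtain ⟨σ, hσ, h⟩ := aux_backward N F hF
    exact ⟨σ, hσ, congrArg (wSum N) h⟩
end
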